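/- arXiv:0802.2567 — 4 statements merged into one kernel-verified Lean document; each statement's English description precedes it below -/
import Mathlib

section
/- Let q be a power of an odd prime. Then any two elements of order 4 in SL(2,F_q) are conjugate in SL(2,F_q); that is, the elements of order 4 form a single conjugacy class. -/
open Polynomial in
lemma aux_sum_sq {F : Type*} [Field F] [Fintype F]
    (hq : Odd (Fintype.card F)) (x : F) : ∃ a b : F, a ^ 2 + b ^ 2 = x := by
  obtain ⟨a, b, hab⟩ := FiniteField.exists_root_sum_quadratic (R := F)
    (f := X ^ 2) (g := X ^ 2 - C x) (degree_X_pow 2) (degree_X_pow_sub_C (by decide) _)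
    (Nat.odd_iff.mp hq)
  refine ⟨a, b, ?_⟩
  rw [← sub_eq_zero]
  simpa only [eval_C, eval_X, eval_pow, eval_sub, ← add_sub_assoc] using hab

lemma aux_two {F : Type*} [Field F] [Fintype F]
    (hq : Odd (Fintype.card F)) : (2 : F) ≠ 0 := by
  apply Ring.two_ne_zero
  intro h
  have := FiniteField.even_card_of_char_two h
  have := Nat.odd_iff.mp hq
  omega

/-- The standard element of order four. -/
def auxJ (F : Type*) [Field F] : Matrix.SpecialLinearGroup (Fin 2) F :=
  ⟨!![0, -1; 1, 0], by simp [Matrix.det_fin_two]⟩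

lemma aux_conj {F : Type*} [Field F] [Fintype F]
    (hq : Odd (Fintype.card F)) (g : Matrix.SpecialLinearGroup (Fin 2) F)
    (hg : orderOf g = 4) :
    IsConj (auxJ F) g := by
  have h2 := aux_two hq
  have h4 : g ^ 4 = 1 := hg ▸ pow_orderOf_eq_one g
  have hn : g ^ 2 ≠ 1 := fun h => by
    have := orderOf_dvd_of_pow_eq_one h
    rw [hg] at this
    omega
  have h5 : g * g = g⁻¹ * g⁻¹ := by
    rw [← mul_inv_rev, eq_inv_iff_mul_eq_one, ← h4]
    simp only [pow_succ, pow_zero, one_mul, mul_assoc]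
  obtain ⟨a, b, c, d, hM⟩ : ∃ a b c d, (g : Matrix (Fin 2) (Fin 2) F) = !![a, b; c, d] :=
    ⟨_, _, _, _, Matrix.eta_fin_two _⟩
  have hdet : a * d - b * c = 1 := by
    have := g.det_coe
    rw [hM] at this
    simpa [Matrix.det_fin_two] using this
  have e := fun i j => congrFun (congrFun (congrArg Subtype.val h5) i) j
  have e00 := e 0 0
  have e01 := e 0 1
  have e10 := e 1 0
  simp [hM, Matrix.mul_apply, Fin.sum_univ_two, Matrix.adjugate_fin_two] at e00 e01 e10
  have htr : a + d = 0 := by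
    by_contra ht
    apply hn
    have hb : b = 0 := by
      apply mul_left_cancel₀ ht
      apply mul_left_cancel₀ h2
      linear_combination e01
    have hc : c = 0 := by
      apply mul_left_cancel₀ ht
      apply mul_left_cancel₀ h2
      linear_combination e10
    have hd : d = a := by
      apply mul_left_cancel₀ ht
      linear_combination -e00
    subst hb hc hd
    ext i j
    fin_cases i <;> fin_cases j <;> simp [hM, pow_two, Matrix.mul_apply, Fin.sum_univ_two]
    all_goals linear_combination hdet
  obtain rfl : d = -a := by linear_combination htr
  obtain ⟨x, y, hxy⟩ : ∃ x y : F, c * x ^ 2 - 2 * a * x * y - b * y ^ 2 = 1 := by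
    by_cases hc : c = 0
    · subst hc
      have ha : a ≠ 0 := by rintro rfl; simp at hdet
      refine ⟨(1 + b) / (-2 * a), 1, ?_⟩
      field_simp
      ring
    · obtain ⟨u, y, huy⟩ := aux_sum_sq hq c
      refine ⟨(u + a * y) / c, y, ?_⟩
      field_simp
      linear_combination huy + y ^ 2 * hdet
  have hP : Matrix.det !![x, a * x + b * y; y, c * x - a * y] = 1 := by
    simp [Matrix.det_fin_two]; linear_combination hxy
  obtain ⟨P, hPv⟩ : ∃ P : Matrix.SpecialLinearGroup (Fin 2) F,
      (P : Matrix (Fin 2) (Fin 2) F) = !![x, a * x + b * y; y, c * x - a * y] := ⟨⟨_, hP⟩, rfl⟩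
  have hJ : (auxJ F : Matrix (Fin 2) (Fin 2) F) = !![0, -1; 1, 0] := rfl
  rw [isConj_iff]
  refine ⟨P, ?_⟩
  · rw [mul_inv_eq_iff_eq_mul]
    ext i j
    fin_cases i <;> fin_cases j <;> simp [hM, hJ, hPv, Matrix.mul_apply, Fin.sum_univ_two]
    · linear_combination x * hdet
    · ring
    · linear_combination y * hdet

/-- In SL(2, F_q) with q a power of an odd prime, any two elements of order 4
are conjugate. -/
theorem isConj_of_orderOf_eq_four {F : Type*} [Field F] [Fintype F]
    (hq : Odd (Fintype.card F)) (g h : Matrix.SpecialLinearGroup (Fin 2) F)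
    (hg : orderOf g = 4) (hh : orderOf h = 4) : IsConj g h :=
  (aux_conj hq g hg).symm.trans (aux_conj hq h hh)
end

section
/- Let q be a power of an odd prime and let Δ be a non-square element of F_q. The centralizer in PGL(2,F_q) of the image of the matrix [[0, Δ],[1, 0]] is isomorphic to the dihedral group of order 2(q+1). -/
open Matrix in
lemma aux_mk_eq {F : Type*} [Field F] (x y : GL (Fin 2) F) :
    ((x : GL (Fin 2) F ⧸ Subgroup.center (GL (Fin 2) F)) = y) ↔
      ∃ c : F, y.val = c • x.val := by
  rw [QuotientGroup.eq, Matrix.GeneralLinearGroup.mem_center_iff_val_mem_range_scalar]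
  have key : ∀ c : F, (Matrix.scalar (Fin 2) c = (x⁻¹ * y).val ↔ y.val = c • x.val) := by
    intro c
    have e : x.val * Matrix.scalar (Fin 2) c = c • x.val := by
      ext i j; simp [mul_comm]
    constructor
    · intro h
      rw [← e, h, ← Units.val_mul, mul_inv_cancel_left]
    · intro h
      rw [Units.val_mul, h, ← e, ← mul_assoc, ← Units.val_mul, inv_mul_cancel, Units.val_one,
        one_mul]
  simp only [Set.mem_range, key]

lemma aux_dihedral {Q : Type*} [Group Q] (C : Subgroup Q) (n : ℕ) [NeZero n] (r s : Q)
    (hr : orderOf r = n) (hs : s * s = 1) (hsr : s * r * s = r⁻¹)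
    (hsn : s ∉ Subgroup.zpowers r)
    (hC : ∀ x, x ∈ C ↔ x ∈ Subgroup.zpowers r ∨ s * x ∈ Subgroup.zpowers r) :
    Nonempty (C ≃* DihedralGroup n) := by
  have hsi : s⁻¹ = s := inv_eq_of_mul_eq_one_left hs
  have hconj : ∀ k : ℤ, r ^ k * s = s * r ^ (-k) := by
    intro k
    have h1 : (s * r * s⁻¹) ^ k = s * r ^ k * s⁻¹ := conj_zpow
    rw [hsi, hsr] at h1
    rw [zpow_neg, ← inv_zpow, h1, ← mul_assoc, ← mul_assoc, hs, one_mul]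
  have hval : ∀ (i : ZMod n) (k : ℤ), (k : ZMod n) = i → r ^ (i.val : ℤ) = r ^ k := by
    intro i k h
    rw [zpow_eq_zpow_iff_modEq, hr, ← ZMod.intCast_eq_intCast_iff, h]
    simp
  let f : DihedralGroup n → Q := fun d => match d with
    | .r i => r ^ (i.val : ℤ)
    | .sr i => s * r ^ (i.val : ℤ)
  have hmul : ∀ a b, f (a * b) = f a * f b := by
    rintro (i | i) (j | j)
    · simp only [f, DihedralGroup.r_mul_r]
      rw [← zpow_add, hval _ ((i.val : ℤ) + j.val) (by simp)]
    · simp only [f, DihedralGroup.r_mul_sr]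
      rw [← mul_assoc, hconj, mul_assoc, ← zpow_add, hval _ (-(i.val : ℤ) + j.val) (by simp; ring)]
    · simp only [f, DihedralGroup.sr_mul_r]
      rw [mul_assoc, ← zpow_add, hval _ ((i.val : ℤ) + j.val) (by simp)]
    · simp only [f, DihedralGroup.sr_mul_sr]
      rw [mul_assoc, ← mul_assoc (r ^ _) s, hconj, mul_assoc s, ← mul_assoc s s, hs, one_mul,
        ← zpow_add, hval _ (-(i.val : ℤ) + j.val) (by simp; ring)]
  let φ : DihedralGroup n →* Q := MonoidHom.mk' f hmul
  have hinj : Function.Injective φ := by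
    rw [injective_iff_map_eq_one]
    rintro (i | i) h
    · change r ^ (i.val : ℤ) = 1 at h
      rw [← orderOf_dvd_iff_zpow_eq_one, hr, ← ZMod.intCast_zmod_eq_zero_iff_dvd] at h
      simp at h
      rw [h]; rfl
    · change s * r ^ (i.val : ℤ) = 1 at h
      exact absurd (by rw [mul_eq_one_iff_eq_inv.1 h]; exact inv_mem (Subgroup.zpow_mem_zpowers _ _)) hsn
  have hrange : φ.range = C := by
    ext x
    rw [hC]
    constructor
    · rintro ⟨i | i, rfl⟩
      · exact Or.inl (Subgroup.zpow_mem_zpowers _ _)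
      · right
        change s * (s * r ^ (i.val : ℤ)) ∈ _
        rw [← mul_assoc, hs, one_mul]
        exact Subgroup.zpow_mem_zpowers _ _
    · rintro (⟨k, hk⟩ | ⟨k, hk⟩)
      · exact ⟨.r (k : ZMod n), (hval _ k rfl).trans hk⟩
      · refine ⟨.sr (k : ZMod n), ?_⟩
        change s * r ^ ((k : ZMod n).val : ℤ) = x
        rw [hval _ k rfl]
        change r ^ k = _ at hk
        rw [hk, ← mul_assoc, hs, one_mul]
  exact ⟨((MonoidHom.ofInjective hinj).trans (MulEquiv.subgroupCongr hrange)).symm⟩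

/-- matrix of multiplication -/
def auxM {F : Type*} [Field F] (Δ : F) :
    QuadraticAlgebra F Δ 0 →* Matrix (Fin 2) (Fin 2) F where
  toFun z := !![z.re, Δ * z.im; z.im, z.re]
  map_one' := by
    have h1 : (1 : QuadraticAlgebra F Δ 0).re = 1 := rfl
    have h2 : (1 : QuadraticAlgebra F Δ 0).im = 0 := rfl
    ext i j; fin_cases i <;> fin_cases j <;> simp [h1, h2]
  map_mul' x y := by
    ext i j; fin_cases i <;> fin_cases j <;> simp [Matrix.mul_apply] <;> ring

/-- Let Δ be a non-square in F_q, q a power of an odd prime. The centralizer in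
PGL(2, F_q) of the image of the matrix [[0, Δ],[1, 0]] is isomorphic to the
dihedral group of order 2(q+1). -/
theorem centralizer_image_antidiag_iso_dihedral {F : Type*} [Field F] [Fintype F]
    (hq : Odd (Fintype.card F)) (Δ : F) (hΔ : ¬ IsSquare Δ)
    (g : Matrix.GeneralLinearGroup (Fin 2) F)
    (hg : (g : Matrix (Fin 2) (Fin 2) F) = !![0, Δ; 1, 0]) :
    Nonempty
      (Subgroup.centralizer
          {(QuotientGroup.mk g :
            Matrix.GeneralLinearGroup (Fin 2) F ⧸
              Subgroup.center (Matrix.GeneralLinearGroup (Fin 2) F))} ≃*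
        DihedralGroup (Fintype.card F + 1)) := by
  have h2 : (2 : F) ≠ 0 := by
    apply Ring.two_ne_zero
    intro h
    have := FiniteField.even_card_of_char_two h
    rw [Nat.odd_iff] at hq
    omega
  have hΔ0 : Δ ≠ 0 := by rintro rfl; exact hΔ (IsSquare.zero)
  have : Fact (∀ r : F, r ^ 2 ≠ Δ + 0 * r) := ⟨fun r h => hΔ ⟨r, by rw [← sq, h]; ring⟩⟩
  let K := QuadraticAlgebra F Δ 0
  have : Finite K := Module.finite_of_finite F
  let ψ₀ : Kˣ →* Matrix.GeneralLinearGroup (Fin 2) F := Units.map (auxM Δ)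
  let Z := Subgroup.center (Matrix.GeneralLinearGroup (Fin 2) F)
  let ψ : Kˣ →* (Matrix.GeneralLinearGroup (Fin 2) F ⧸ Z) := (QuotientGroup.mk' Z).comp ψ₀
  have hψ₀ : ∀ z : Kˣ, (ψ₀ z).val = !![z.val.re, Δ * z.val.im; z.val.im, z.val.re] := fun z => rfl
  have hψ : ∀ z : Kˣ, ψ z = (ψ₀ z : Matrix.GeneralLinearGroup (Fin 2) F ⧸ Z) := fun z => rfl
  -- kernel
  have hker : ψ.ker = (Units.map (algebraMap F K).toMonoidHom).range := by
    ext z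
    rw [MonoidHom.mem_ker, hψ, eq_comm, ← QuotientGroup.mk_one, aux_mk_eq]
    constructor
    · rintro ⟨c, hc⟩
      rw [hψ₀] at hc
      have h1 := congrFun (congrFun hc 1) 0
      simp at h1
      have hz : z.val = algebraMap F K z.val.re := by
        ext
        · rfl
        · exact h1
      have hne : z.val.re ≠ 0 := by
        intro h0
        apply z.ne_zero
        rw [hz, h0, map_zero]
      exact ⟨Units.mk0 _ hne, Units.ext hz.symm⟩
    · rintro ⟨u, rfl⟩
      refine ⟨u, ?_⟩
      rw [hψ₀]
      ext i j; fin_cases i <;> fin_cases j <;> simp [K]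
  have hcardK : Nat.card Kˣ = Fintype.card F ^ 2 - 1 := by
    rw [Nat.card_units, Module.natCard_eq_pow_finrank (K := F),
      QuadraticAlgebra.finrank_eq_two, Nat.card_eq_fintype_card]
  have hcardker : Nat.card ψ.ker = Fintype.card F - 1 := by
    rw [hker, ← Nat.card_eq_fintype_card, ← Nat.card_units F]
    refine (Nat.card_congr (MonoidHom.ofInjective ?_).toEquiv).symm
    exact Units.map_injective (algebraMap F K).injective
  have hcardrange : Nat.card ψ.range = Fintype.card F + 1 := by
    have h := Subgroup.card_mul_index ψ.ker
    rw [Subgroup.index_ker, hcardK, hcardker] at h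
    have h1 : 1 < Fintype.card F := Fintype.one_lt_card
    have h3 : Fintype.card F ^ 2 - 1 = (Fintype.card F - 1) * (Fintype.card F + 1) := by
      rw [mul_comm]; simpa using Nat.sq_sub_sq (Fintype.card F) 1
    rw [h3] at h
    exact Nat.eq_of_mul_eq_mul_left (by omega) h
  obtain ⟨ζ, hζ⟩ := IsCyclic.exists_generator (α := Kˣ)
  have hzp : Subgroup.zpowers (ψ ζ) = ψ.range := by
    rw [← MonoidHom.map_zpowers, (Subgroup.eq_top_iff' _).2 hζ, MonoidHom.range_eq_map]
  let s₀ : Matrix.GeneralLinearGroup (Fin 2) F :=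
    ⟨!![1, 0; 0, -1], !![1, 0; 0, -1],
      by ext i j; fin_cases i <;> fin_cases j <;> simp [Matrix.mul_apply],
      by ext i j; fin_cases i <;> fin_cases j <;> simp [Matrix.mul_apply]⟩
  have hs₀ : s₀.val = !![1, 0; 0, -1] := rfl
  have hrange : ∀ x : Matrix.GeneralLinearGroup (Fin 2) F,
      (x : Matrix.GeneralLinearGroup (Fin 2) F ⧸ Z) ∈ ψ.range ↔
        x.val 0 0 = x.val 1 1 ∧ x.val 0 1 = Δ * x.val 1 0 := by
    intro x
    constructor
    · rintro ⟨z, hz⟩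
      rw [hψ, aux_mk_eq] at hz
      obtain ⟨c, hc⟩ := hz
      rw [hc, hψ₀]
      constructor
      · simp
      · simp; ring
    · rintro ⟨ha, hb⟩
      let z : K := ⟨x.val 0 0, x.val 1 0⟩
      have hx : x.val = auxM Δ z := by
        ext i j; fin_cases i <;> fin_cases j <;> simp [auxM, z, ha, hb]
      have hz : z ≠ 0 := by
        intro h
        have : x.val = 0 := by
          rw [hx, h]
          ext i j; fin_cases i <;> fin_cases j <;> simp [auxM]
        exact x.ne_zero this
      refine ⟨Units.mk0 z hz, ?_⟩
      rw [hψ]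
      congr 1
      exact Units.ext hx.symm
  refine aux_dihedral _ _ (ψ ζ) (s₀ : Matrix.GeneralLinearGroup (Fin 2) F ⧸ Z) ?_ ?_ ?_ ?_ ?_
  · rw [← Nat.card_zpowers, hzp, hcardrange]
  · rw [← QuotientGroup.mk_mul]
    have : s₀ * s₀ = 1 := s₀.val_inv |> fun h => Units.ext h
    rw [this, QuotientGroup.mk_one]
  · rw [eq_inv_iff_mul_eq_one, hψ, ← QuotientGroup.mk_mul, ← QuotientGroup.mk_mul,
      ← QuotientGroup.mk_mul, eq_comm, ← QuotientGroup.mk_one, aux_mk_eq]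
    refine ⟨ζ.val.re ^ 2 - Δ * ζ.val.im ^ 2, ?_⟩
    simp only [Units.val_mul, hs₀, hψ₀]
    ext i j; fin_cases i <;> fin_cases j <;> simp [Matrix.mul_apply] <;> ring
  · rw [hzp, hrange, hs₀]
    rintro ⟨h, -⟩
    simp at h
    apply h2
    linear_combination h
  · intro y
    obtain ⟨x, rfl⟩ := QuotientGroup.mk_surjective y
    rw [hzp, ← QuotientGroup.mk_mul, hrange, hrange, Subgroup.mem_centralizer_singleton_iff,
      ← QuotientGroup.mk_mul, ← QuotientGroup.mk_mul, aux_mk_eq]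
    simp only [Units.val_mul, hs₀, hg]
    have hx0 := x.ne_zero
    generalize x.val = m at hx0
    have hm : m = !![m 0 0, m 0 1; m 1 0, m 1 1] := Matrix.eta_fin_two m
    generalize m 0 0 = a at hm
    generalize m 0 1 = b at hm
    generalize m 1 0 = c at hm
    generalize m 1 1 = d at hm
    subst hm
    have hx1 : ¬ (a = 0 ∧ b = 0 ∧ c = 0 ∧ d = 0) := by
      rintro ⟨rfl, rfl, rfl, rfl⟩
      apply hx0
      ext i j; fin_cases i <;> fin_cases j <;> rfl
    simp [Matrix.mul_apply]
    constructor
    · rintro ⟨l, ⟨e1, e2⟩, e3, e4⟩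
      have e2' : d = l * a := mul_left_cancel₀ hΔ0 (by linear_combination e2)
      have hl : (l - 1) * (l + 1) = 0 := by
        by_contra hne
        have ha : a = 0 := (mul_eq_zero.1
          (show ((l - 1) * (l + 1)) * a = 0 by linear_combination -e3 - l * e2')).resolve_left hne
        have hb : b = 0 := (mul_eq_zero.1
          (show ((l - 1) * (l + 1)) * b = 0 by linear_combination -e4 - l * e1)).resolve_left hne
        have hc : c = 0 := by
          have : Δ * c = 0 := by rw [e1, hb, mul_zero]
          exact (mul_eq_zero.1 this).resolve_left hΔ0
        exact hx1 ⟨ha, hb, hc, by rw [e2', ha, mul_zero]⟩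
      rcases mul_eq_zero.1 hl with h | h
      · left
        have : l = 1 := by linear_combination h
        subst this
        exact ⟨by linear_combination e3, by linear_combination e4⟩
      · right
        have : l = -1 := by linear_combination h
        subst this
        exact ⟨by linear_combination e3, by linear_combination e4⟩
    · rintro (⟨rfl, rfl⟩ | ⟨rfl, rfl⟩)
      · exact ⟨1, ⟨by ring, by ring⟩, by ring, by ring⟩
      · exact ⟨-1, ⟨by ring, by ring⟩, by ring, by ring⟩
end

section
/- Let q be a prime power with q ≡ 3 (mod 4), let Δ be a non-square element of F_q, and let x, y ∈ F_q satisfy x^2 - Δ y^2 = 1 with x ≠ 0 and y ≠ 0. The centralizer in PSL(2,F_q) of the image of the matrix [[x, Δy],[y, x]] ∈ SL(2,F_q) is cyclic of order (q+1)/2. -/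
section aux
variable {F : Type*} [Field F] [Fintype F] (Δ : F)

abbrev NT : Subgroup (QuadraticAlgebra F Δ 0)ˣ :=
  (Units.map (QuadraticAlgebra.norm : QuadraticAlgebra F Δ 0 →* F)).ker

lemma NT_mem {Δ : F} (z : (QuadraticAlgebra F Δ 0)ˣ) :
    z ∈ NT Δ ↔ z.1.re * z.1.re - Δ * z.1.im * z.1.im = 1 := by
  rw [MonoidHom.mem_ker, Units.ext_iff]
  simp [QuadraticAlgebra.norm_def, mul_assoc]

lemma nt_re_one : (1 : QuadraticAlgebra F Δ 0).re = 1 := rfl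
lemma nt_im_one : (1 : QuadraticAlgebra F Δ 0).im = 0 := rfl

def ntHom : NT Δ →* Matrix.SpecialLinearGroup (Fin 2) F where
  toFun z := ⟨!![z.1.1.re, Δ * z.1.1.im; z.1.1.im, z.1.1.re], by
    have := (NT_mem z.1).1 z.2
    rw [Matrix.det_fin_two_of]; linear_combination this⟩
  map_one' := by
    ext i j; fin_cases i <;> fin_cases j <;> simp [nt_re_one, nt_im_one]
  map_mul' a b := by
    apply Subtype.ext
    change !![_, _; _, _] = !![a.1.1.re, Δ * a.1.1.im; a.1.1.im, a.1.1.re] *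
      !![b.1.1.re, Δ * b.1.1.im; b.1.1.im, b.1.1.re]
    ext i j
    fin_cases i <;> fin_cases j <;> simp [Matrix.mul_apply, Fin.sum_univ_two] <;> ring

lemma ntHom_coe (z : NT Δ) : (ntHom Δ z : Matrix (Fin 2) (Fin 2) F) =
    !![z.1.1.re, Δ * z.1.1.im; z.1.1.im, z.1.1.re] := rfl

lemma NT_mk {Δ : F} (a c : F) (h : a * a - Δ * c * c = 1) :
    ∃ z : NT Δ, z.1.1 = ⟨a, c⟩ := by
  have e : (⟨a, c⟩ : QuadraticAlgebra F Δ 0) * ⟨a, -c⟩ = 1 := by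
    ext <;> simp [nt_re_one, nt_im_one]
    · linear_combination h
    · ring
  let u : (QuadraticAlgebra F Δ 0)ˣ := ⟨⟨a, c⟩, ⟨a, -c⟩, e, by rw [mul_comm]; exact e⟩
  exact ⟨⟨u, (NT_mem u).2 h⟩, rfl⟩

lemma NT_cyclic {Δ : F} (hΔ : ¬ IsSquare Δ) : IsCyclic (NT Δ) := by
  have : Fact (∀ r : F, r ^ 2 ≠ Δ + 0 * r) := ⟨fun r h => hΔ ⟨r, by linear_combination -h⟩⟩
  have : Finite (QuadraticAlgebra F Δ 0) := Finite.of_equiv _ (QuadraticAlgebra.equivProd Δ 0).symm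
  infer_instance

lemma NT_card {Δ : F} (hΔ : ¬ IsSquare Δ) (hq : Fintype.card F % 2 = 1) :
    Nat.card (NT Δ) = Fintype.card F + 1 := by
  have : Fact (∀ r : F, r ^ 2 ≠ Δ + 0 * r) := ⟨fun r h => hΔ ⟨r, by linear_combination -h⟩⟩
  have : Finite (QuadraticAlgebra F Δ 0) := Finite.of_equiv _ (QuadraticAlgebra.equivProd Δ 0).symm
  have hΔ0 : Δ ≠ 0 := by rintro rfl; exact hΔ ⟨0, by simp⟩
  have hs : Function.Surjective
      (Units.map (QuadraticAlgebra.norm : QuadraticAlgebra F Δ 0 →* F)) := by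
    intro u
    obtain ⟨a, b, hab⟩ := FiniteField.exists_root_sum_quadratic
      (f := (Polynomial.X ^ 2 - Polynomial.C (u : F) : Polynomial F))
      (g := (Polynomial.C (-Δ) * Polynomial.X ^ 2 : Polynomial F))
      (Polynomial.degree_X_pow_sub_C (by norm_num) _)
      (Polynomial.degree_C_mul_X_pow 2 (neg_ne_zero.2 hΔ0)) hq
    simp at hab
    have hn : QuadraticAlgebra.norm (⟨a, b⟩ : QuadraticAlgebra F Δ 0) = u := by
      simp [QuadraticAlgebra.norm_def]
      linear_combination hab
    have hz : (⟨a, b⟩ : QuadraticAlgebra F Δ 0) ≠ 0 := by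
      intro h; rw [h] at hn; simp at hn; exact u.ne_zero hn.symm
    exact ⟨Units.mk0 _ hz, Units.ext (by simpa using hn)⟩
  have h1 := (NT Δ).card_mul_index
  rw [Subgroup.index_ker, MonoidHom.range_eq_top.2 hs, Subgroup.card_top, Nat.card_units,
    Nat.card_units, Nat.card_congr (QuadraticAlgebra.equivProd Δ 0), Nat.card_prod,
    Nat.card_eq_fintype_card (α := F)] at h1
  have h2 : 1 < Fintype.card F := Fintype.one_lt_card
  obtain ⟨m, hm⟩ : ∃ m, Fintype.card F = m + 2 := ⟨_, (Nat.sub_add_cancel h2).symm⟩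
  rw [hm] at h1 ⊢
  have h3 : (m + 2) * (m + 2) - 1 = (m + 2 + 1) * (m + 2 - 1) := by
    have : m + 2 - 1 = m + 1 := rfl
    rw [this]
    apply Nat.sub_eq_of_eq_add; ring
  rw [h3] at h1
  exact Nat.eq_of_mul_eq_mul_right (by omega) h1

end aux

/-- Let q ≡ 3 (mod 4), Δ a non-square in F_q, and x, y ∈ F_q with
x² - Δy² = 1, x ≠ 0 and y ≠ 0. The centralizer in PSL(2, F_q) of the image of
the matrix [[x, Δy],[y, x]] ∈ SL(2, F_q) is cyclic of order (q + 1)/2. -/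
theorem centralizer_image_nonsplit_torus_cyclic {F : Type*} [Field F] [Fintype F]
    (hq : Fintype.card F % 4 = 3) (Δ : F) (hΔ : ¬ IsSquare Δ) (x y : F)
    (hxy : x ^ 2 - Δ * y ^ 2 = 1) (hx : x ≠ 0) (hy : y ≠ 0)
    (g : Matrix.SpecialLinearGroup (Fin 2) F)
    (hg : (g : Matrix (Fin 2) (Fin 2) F) = !![x, Δ * y; y, x]) :
    IsCyclic
      (Subgroup.centralizer
        {(QuotientGroup.mk g :
          Matrix.SpecialLinearGroup (Fin 2) F ⧸
            Subgroup.center (Matrix.SpecialLinearGroup (Fin 2) F))}) ∧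
    Nat.card
        (Subgroup.centralizer
          {(QuotientGroup.mk g :
            Matrix.SpecialLinearGroup (Fin 2) F ⧸
              Subgroup.center (Matrix.SpecialLinearGroup (Fin 2) F))}) =
      (Fintype.card F + 1) / 2 := by
  have h2 : (2 : F) ≠ 0 := by
    intro h
    have hc : ringChar F = 2 := CharP.ringChar_of_prime_eq_zero Nat.prime_two (by exact_mod_cast h)
    have := FiniteField.even_card_of_char_two hc
    omega
  have hΔ0 : Δ ≠ 0 := by rintro rfl; exact hΔ ⟨0, by simp⟩
  let ψ := (QuotientGroup.mk' (Subgroup.center (Matrix.SpecialLinearGroup (Fin 2) F))).comp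
    (ntHom Δ)
  obtain ⟨z0, hz0⟩ := NT_mk (Δ := Δ) x y (by linear_combination hxy)
  have hgz : ntHom Δ z0 = g := by
    apply Subtype.ext
    rw [hg, ntHom_coe, hz0]
  have := NT_cyclic hΔ
  have hrange : Subgroup.centralizer
        {(QuotientGroup.mk g :
          Matrix.SpecialLinearGroup (Fin 2) F ⧸
            Subgroup.center (Matrix.SpecialLinearGroup (Fin 2) F))} = ψ.range := by
    apply le_antisymm
    · intro k hk
      obtain ⟨h, rfl⟩ := QuotientGroup.mk_surjective k
      rw [Subgroup.mem_centralizer_singleton_iff, ← QuotientGroup.mk_mul, ← QuotientGroup.mk_mul,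
        QuotientGroup.eq, Matrix.SpecialLinearGroup.mem_center_iff] at hk
      obtain ⟨r, hr, hr'⟩ := hk
      have e : (h * g).1 * (Matrix.scalar (Fin 2) r) = (g * h).1 := by
        rw [hr', ← Matrix.SpecialLinearGroup.coe_mul, mul_inv_cancel_left]
      have hd := h.2
      rw [Matrix.det_fin_two] at hd
      rw [Matrix.SpecialLinearGroup.coe_mul, Matrix.SpecialLinearGroup.coe_mul, hg] at e
      have e00 := congrFun (congrFun e 0) 0
      have e01 := congrFun (congrFun e 0) 1
      have e10 := congrFun (congrFun e 1) 0
      have e11 := congrFun (congrFun e 1) 1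
      simp [Matrix.mul_apply, Fin.sum_univ_two] at e00 e01 e10 e11
      obtain ⟨a, ha⟩ : ∃ a, h.1 0 0 = a := ⟨_, rfl⟩
      obtain ⟨b, hb⟩ : ∃ a, h.1 0 1 = a := ⟨_, rfl⟩
      obtain ⟨c, hc⟩ : ∃ a, h.1 1 0 = a := ⟨_, rfl⟩
      obtain ⟨d, hd'⟩ : ∃ a, h.1 1 1 = a := ⟨_, rfl⟩
      simp only [ha, hb, hc, hd'] at e00 e01 e10 e11 hd
      have hr1 : r = 1 ∨ r = -1 := by
        simpa using hr
      have key : a = d ∧ b = Δ * c := by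
        rcases hr1 with rfl | rfl
        · constructor
          · apply mul_left_cancel₀ hy; linear_combination -e10
          · apply mul_left_cancel₀ hy; linear_combination e00
        · constructor
          · apply mul_left_cancel₀ (mul_ne_zero h2 hx); linear_combination e11 - e00
          · apply mul_left_cancel₀ (mul_ne_zero h2 hx); linear_combination -e01 + Δ * e10
      obtain ⟨rfl, rfl⟩ := key
      obtain ⟨z, hz⟩ := NT_mk (Δ := Δ) a c (by linear_combination hd)
      refine ⟨z, ?_⟩
      have : ntHom Δ z = h := by
        apply Subtype.ext
        rw [ntHom_coe, hz]
        ext i j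
        fin_cases i <;> fin_cases j
        · exact ha.symm
        · exact hb.symm
        · exact hc.symm
        · exact hd'.symm
      change QuotientGroup.mk (ntHom Δ z) = _
      rw [this]
    · rintro _ ⟨z, rfl⟩
      rw [Subgroup.mem_centralizer_singleton_iff, ← hgz]
      change ψ z * ψ z0 = ψ z0 * ψ z
      rw [← map_mul, mul_comm, map_mul]
  rw [hrange]
  refine ⟨isCyclic_of_surjective ψ.rangeRestrict ψ.rangeRestrict_surjective, ?_⟩
  have hk : Nat.card ψ.ker = 2 := by
    have hset : (ψ.ker : Set (NT Δ)) = {1, ⟨-1, (NT_mem _).2 (by simp [nt_re_one, nt_im_one])⟩} := by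
      ext z
      simp only [SetLike.mem_coe, MonoidHom.mem_ker, Set.mem_insert_iff, Set.mem_singleton_iff]
      change QuotientGroup.mk (ntHom Δ z) = _ ↔ _
      rw [QuotientGroup.eq_one_iff, Matrix.SpecialLinearGroup.mem_center_iff]
      constructor
      · rintro ⟨r, hr, hr'⟩
        have hr1 : r = 1 ∨ r = -1 := by simpa using hr
        have e00 := congrFun (congrFun hr' 0) 0
        have e10 := congrFun (congrFun hr' 1) 0
        rw [ntHom_coe] at e00 e10
        simp at e00 e10
        rcases hr1 with rfl | rfl
        · left
          apply Subtype.ext; apply Units.ext; ext <;> simp [← e00, ← e10, nt_re_one, nt_im_one]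
        · right
          apply Subtype.ext; apply Units.ext; ext <;> simp [← e00, ← e10, nt_re_one, nt_im_one]
      · rintro (rfl | rfl)
        · exact ⟨1, by simp, by simp⟩
        · refine ⟨-1, by simp, ?_⟩
          rw [ntHom_coe]
          ext i j; fin_cases i <;> fin_cases j <;> simp [nt_re_one, nt_im_one]
    have : Nat.card ψ.ker = (ψ.ker : Set (NT Δ)).ncard := rfl
    rw [this, hset, Set.ncard_pair]
    intro h
    have := congrArg (fun z : NT Δ => z.1.1.re) h
    simp [nt_re_one] at this
    apply h2; linear_combination this
  have h1 := ψ.ker.card_mul_index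
  rw [Subgroup.index_ker, hk, NT_card hΔ (by omega)] at h1
  omega
end

section
/- In PSL(3,F_4), every element of order 3 and every element of order 5 is conjugate to its inverse; that is, the conjugacy classes of elements of order 3 and of order 5 are real. -/
namespace PslAux
open Matrix

variable {K : Type*} [Field K]

/-- Matrix with three given columns. -/
def cols (u v w : Fin 3 → K) : Matrix (Fin 3) (Fin 3) K :=
  Matrix.of fun i j => (![u i, v i, w i] : Fin 3 → K) j

theorem cols0 (u v w : Fin 3 → K) : cols u v w *ᵥ ![1, 0, 0] = u := by
  ext i; simp [cols, mulVec, dotProduct, Fin.sum_univ_three]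
theorem cols1 (u v w : Fin 3 → K) : cols u v w *ᵥ ![0, 1, 0] = v := by
  ext i; simp [cols, mulVec, dotProduct, Fin.sum_univ_three]
theorem cols2 (u v w : Fin 3 → K) : cols u v w *ᵥ ![0, 0, 1] = w := by
  ext i; simp [cols, mulVec, dotProduct, Fin.sum_univ_three]

theorem mul_cols (P : Matrix (Fin 3) (Fin 3) K) (u v w : Fin 3 → K) :
    P * cols u v w = cols (P *ᵥ u) (P *ᵥ v) (P *ᵥ w) := by
  ext i j
  fin_cases j <;> simp [cols, mul_apply, mulVec, dotProduct, Fin.sum_univ_three]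

theorem exists_basis (A : Matrix (Fin 3) (Fin 3) K)
    (h : ∀ v w : Fin 3 → K, (cols v (A *ᵥ v) w).det = 0) : ∃ l : K, A = l • 1 := by
  have e1 := h ![1,0,0] ![0,1,0]
  have e2 := h ![1,0,0] ![0,0,1]
  have e3 := h ![0,1,0] ![1,0,0]
  have e4 := h ![0,1,0] ![0,0,1]
  have e5 := h ![0,0,1] ![1,0,0]
  have e6 := h ![0,0,1] ![0,1,0]
  have e7 := h ![1,1,0] ![0,0,1]
  have e8 := h ![1,0,1] ![0,1,0]
  simp [cols, det_fin_three, mulVec, dotProduct, Fin.sum_univ_three] at e1 e2 e3 e4 e5 e6 e7 e8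
  refine ⟨A 0 0, ?_⟩
  ext i j
  fin_cases i <;> fin_cases j <;> simp <;> grind

theorem conj_det (A P : Matrix (Fin 3) (Fin 3) K) (hP : P.det ≠ 0)
    (u v w : Fin 3 → K) (h : (cols (P *ᵥ u) (P *ᵥ v) (P *ᵥ w)).det = 0) :
    (cols u v w).det = 0 := by
  rw [← mul_cols, det_mul] at h
  simpa [hP] using h

/-- noncyclic implies square scalar -/
theorem sq_scalar [CharP K 2] (A : Matrix (Fin 3) (Fin 3) K) (hA : A.det = 1)
    (h4 : ∀ x : K, x ^ 4 = x)
    (h : ∀ u : Fin 3 → K, (cols u (A *ᵥ u) (A *ᵥ (A *ᵥ u))).det = 0) :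
    ∃ l : K, A * A = l • 1 := by
  have two : (2 : K) = 0 := CharTwo.two_eq_zero
  by_cases hs : ∀ v w : Fin 3 → K, (cols v (A *ᵥ v) w).det = 0
  · obtain ⟨l, hl⟩ := exists_basis A hs
    exact ⟨l * l, by rw [hl]; simp [smul_smul]⟩
  push Not at hs
  obtain ⟨v, w, hP⟩ := hs
  set P := cols v (A *ᵥ v) w with hPd
  have hu : IsUnit P.det := isUnit_iff_ne_zero.mpr hP
  obtain ⟨C, hC⟩ : ∃ C, C = P⁻¹ * A * P := ⟨_, rfl⟩
  have hPC : P * C = A * P := by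
    rw [hC, ← mul_assoc, ← mul_assoc, mul_nonsing_inv _ hu, one_mul]
  have hCdet : C.det = 1 := by
    have := congrArg det hPC
    rw [det_mul, det_mul, hA, one_mul] at this
    exact mul_left_cancel₀ hP (by rw [this, mul_one])
  have hv : ∀ u, P *ᵥ (C *ᵥ u) = A *ᵥ (P *ᵥ u) := by
    intro u; rw [mulVec_mulVec, hPC, mulVec_mulVec]
  have hinj : ∀ x y, P *ᵥ x = P *ᵥ y → x = y := by
    intro x y hxy
    have := congrArg (P⁻¹ *ᵥ ·) hxy
    simpa [mulVec_mulVec, nonsing_inv_mul _ hu] using this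
  have hC0 : C *ᵥ ![1,0,0] = ![0,1,0] := by
    apply hinj; rw [hv, hPd, cols0, cols1]
  have hCf : ∀ u : Fin 3 → K, (cols u (C *ᵥ u) (C *ᵥ (C *ᵥ u))).det = 0 := by
    intro u
    apply conj_det A P hP
    rw [hv, hv, hv]; exact h _
  have c00 := congrFun hC0 0
  have c10 := congrFun hC0 1
  have c20 := congrFun hC0 2
  simp [mulVec, dotProduct, Fin.sum_univ_three] at c00 c10 c20
  have f0 := hCf ![1,0,0]
  simp [cols, det_fin_three, mulVec, dotProduct, Fin.sum_univ_three, c00, c10, c20] at f0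
  rw [det_fin_three] at hCdet
  simp [c00, c10, c20, f0] at hCdet
  have key : ∃ l : K, C * C = l • 1 := by
    have F : ∀ α β : K, _ := fun α β => hCf ![α, β, 1]
    simp [cols, det_fin_three, mulVec, dotProduct, Fin.sum_univ_three, c00, c10, c20, f0] at F
    generalize hb : C 0 1 = b at *
    generalize hx : C 0 2 = x at *
    generalize hc : C 1 1 = c at *
    generalize hy : C 1 2 = y at *
    generalize hl : C 2 2 = l at *
    have hbl : b * l = 1 := by grind
    have hl0 : l ≠ 0 := by grind
    have hl3 : l ^ 3 = 1 := by
      have := h4 l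
      apply mul_left_cancel₀ hl0
      linear_combination this
    have hb2 : b = l ^ 2 := by linear_combination l ^ 2 * hbl - b * hl3
    have hc0 : c = 0 := by
      by_contra hc0
      obtain ⟨β, hβ⟩ : ∃ β, l * c * β = 1 + x + l * y :=
        ⟨(1 + x + l * y) / (l * c), by field_simp⟩
      obtain ⟨α, hα⟩ : ∃ α, α = y + (c + l) * β := ⟨_, rfl⟩
      have hF := F α β
      have hp : b * β + x = 1 + l * α := by grind
      have hq : α + c * β + y = l * β := by grind
      rw [hp, hq] at hF
      grind
    have hxy : x = l * y := by
      have hF := F 0 0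
      have : (x + l * y) ^ 2 = 0 := by grind
      have := pow_eq_zero_iff (two_ne_zero) |>.mp this
      grind
    refine ⟨l ^ 2, ?_⟩
    ext i j
    clear hC hPC hv hinj hC0 hCf h hu hP F
    fin_cases i <;> fin_cases j <;>
      simp [mul_apply, Fin.sum_univ_three, c00, c10, c20, f0, hb, hx, hc, hy, hl] <;> grind
  obtain ⟨l, hl⟩ := key
  refine ⟨l, ?_⟩
  have : A * A * P = (l • 1) * P := by
    rw [mul_assoc, ← hPC, ← mul_assoc, ← hPC, mul_assoc, hl]; simp
  have := congrArg (· * P⁻¹) this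
  simpa [mul_assoc, mul_nonsing_inv _ hu] using this

theorem companion [CharP K 2] (C : Matrix (Fin 3) (Fin 3) K) (hC : C.det = 1)
    (hC0 : C *ᵥ ![1,0,0] = ![0,1,0]) (hC1 : C *ᵥ ![0,1,0] = ![0,0,1])
    (c : K) (h : C ^ 3 = c • 1 ∨ C ^ 5 = c • 1) (h4 : ∀ x : K, x ^ 4 = x) :
    ∃ (l : K) (X : Matrix (Fin 3) (Fin 3) K), l ^ 3 = 1 ∧ X.det = 1 ∧ C * X * C = l • X := by
  have two : (2 : K) = 0 := CharTwo.two_eq_zero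
  have c00 := congrFun hC0 0
  have c10 := congrFun hC0 1
  have c20 := congrFun hC0 2
  have c01 := congrFun hC1 0
  have c11 := congrFun hC1 1
  have c21 := congrFun hC1 2
  simp [mulVec, dotProduct, Fin.sum_univ_three] at c00 c10 c20 c01 c11 c21
  rw [det_fin_three] at hC
  simp [c00, c10, c20, c01, c11, c21] at hC
  obtain ⟨t, ht⟩ : ∃ t, C 1 2 = t := ⟨_, rfl⟩
  obtain ⟨s, hs⟩ : ∃ s, C 2 2 = s := ⟨_, rfl⟩
  have hCe : C = !![0,0,1;1,0,t;0,1,s] := by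
    ext i j
    fin_cases i <;> fin_cases j <;> simp [*]
  have hl : ∃ l : K, l ^ 3 = 1 ∧ s = l * t := by
    rcases h with h | h
    · have a1 := congrFun (congrFun h 1) 0
      have a2 := congrFun (congrFun h 2) 0
      simp [hCe, pow_succ, mul_apply, Fin.sum_univ_three] at a1 a2
      exact ⟨1, by simp, by grind⟩
    · have a1 := congrFun (congrFun h 1) 0
      have a2 := congrFun (congrFun h 2) 0
      simp [hCe, pow_succ, mul_apply, Fin.sum_univ_three] at a1 a2
      have hs0 : s ^ 3 = 1 := by grind
      have ht0 : t ≠ 0 := by grind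
      have ht4 := h4 t
      refine ⟨s * t ^ 2, ?_, ?_⟩ <;> grind
  obtain ⟨l, hl3, hst⟩ := hl
  refine ⟨l, !![1, l*t, l^2*(t^2+s); 0, l*s, l^2*(s*t+1); 0, l, l^2*t], hl3, ?_, ?_⟩
  · rw [det_fin_three]; simp; grind
  · rw [hCe]; ext i j
    fin_cases i <;> fin_cases j <;> simp [mul_apply, Fin.sum_univ_three] <;> grind

theorem cyc [CharP K 2] (A : Matrix (Fin 3) (Fin 3) K) (hA : A.det = 1)
    (h4 : ∀ x : K, x ^ 4 = x) (u : Fin 3 → K)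
    (hP : (cols u (A *ᵥ u) (A *ᵥ (A *ᵥ u))).det ≠ 0)
    (c : K) (h : A ^ 3 = c • 1 ∨ A ^ 5 = c • 1) :
    ∃ (l : K) (X : Matrix (Fin 3) (Fin 3) K), l ^ 3 = 1 ∧ X.det = 1 ∧ A * X * A = l • X := by
  set P := cols u (A *ᵥ u) (A *ᵥ (A *ᵥ u)) with hPd
  have hu : IsUnit P.det := isUnit_iff_ne_zero.mpr hP
  obtain ⟨C, hC⟩ : ∃ C, C = P⁻¹ * A * P := ⟨_, rfl⟩
  have hPC : P * C = A * P := by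
    rw [hC, ← mul_assoc, ← mul_assoc, mul_nonsing_inv _ hu, one_mul]
  have hCdet : C.det = 1 := by
    have := congrArg det hPC
    rw [det_mul, det_mul, hA, one_mul] at this
    exact mul_left_cancel₀ hP (by rw [this, mul_one])
  have hv : ∀ u, P *ᵥ (C *ᵥ u) = A *ᵥ (P *ᵥ u) := by
    intro u; rw [mulVec_mulVec, hPC, mulVec_mulVec]
  have hinj : ∀ x y, P *ᵥ x = P *ᵥ y → x = y := by
    intro x y hxy
    have := congrArg (P⁻¹ *ᵥ ·) hxy
    simpa [mulVec_mulVec, nonsing_inv_mul _ hu] using this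
  have hC0 : C *ᵥ ![1,0,0] = ![0,1,0] := by
    apply hinj; rw [hv, hPd, cols0, cols1]
  have hC1 : C *ᵥ ![0,1,0] = ![0,0,1] := by
    apply hinj; rw [hv, hPd, cols1, cols2]
  have hpow : ∀ n : ℕ, P * C ^ n = A ^ n * P := by
    intro n
    have : SemiconjBy P C A := hPC
    exact this.pow_right n
  have hsc : ∀ n : ℕ, A ^ n = c • 1 → C ^ n = c • 1 := by
    intro n hn
    have h1 := hpow n
    rw [hn] at h1
    have := congrArg (P⁻¹ * ·) h1
    simpa [← mul_assoc, nonsing_inv_mul _ hu] using this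
  obtain ⟨l, X, hl, hX, hCX⟩ := companion C hCdet hC0 hC1 c (h.imp (hsc 3) (hsc 5)) h4
  refine ⟨l, P * X * P⁻¹, hl, ?_, ?_⟩
  · rw [det_conj ((isUnit_iff_isUnit_det P).mpr hu), hX]
  · have hA' : A = P * C * P⁻¹ := by
      rw [hPC, mul_assoc, mul_nonsing_inv _ hu, mul_one]
    have hi := nonsing_inv_mul _ hu
    calc A * (P * X * P⁻¹) * A = P * C * (P⁻¹ * P) * X * (P⁻¹ * P) * C * P⁻¹ := by
          rw [hA']; simp only [mul_assoc]
      _ = P * (C * X * C) * P⁻¹ := by rw [hi]; simp only [mul_assoc, mul_one]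
      _ = _ := by rw [hCX]; simp

end PslAux

/-- In PSL(3, F₄) (the Mathieu group M₂₁), every element of order 3 and every
element of order 5 is conjugate to its inverse: these classes are real. -/
theorem psl3_f4_order_three_five_real
    (g : Matrix.SpecialLinearGroup (Fin 3) (GaloisField 2 2) ⧸
      Subgroup.center (Matrix.SpecialLinearGroup (Fin 3) (GaloisField 2 2)))
    (hg : orderOf g = 3 ∨ orderOf g = 5) :
    IsConj g g⁻¹ := by
  have h4 : ∀ x : GaloisField 2 2, x ^ 4 = x := by
    intro x
    letI := Fintype.ofFinite (GaloisField 2 2)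
    have hc : Fintype.card (GaloisField 2 2) = 4 := by
      rw [← Nat.card_eq_fintype_card, GaloisField.card 2 2 (by norm_num)]; norm_num
    have := FiniteField.pow_card x
    rwa [hc] at this
  obtain ⟨A, rfl⟩ := QuotientGroup.mk_surjective g
  have hcen : ∀ n : ℕ, (QuotientGroup.mk A : Matrix.SpecialLinearGroup (Fin 3) (GaloisField 2 2) ⧸
      Subgroup.center (Matrix.SpecialLinearGroup (Fin 3) (GaloisField 2 2))) ^ n = 1 →
      ∃ c : GaloisField 2 2, A.1 ^ n = c • 1 := by
    intro n hn
    rw [← QuotientGroup.mk_pow, QuotientGroup.eq_one_iff,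
      Matrix.SpecialLinearGroup.mem_center_iff] at hn
    obtain ⟨r, -, hr⟩ := hn
    refine ⟨r, ?_⟩
    rw [← Matrix.SpecialLinearGroup.coe_pow, ← hr, Matrix.scalar_apply, Matrix.smul_one_eq_diagonal]
  have hpow : ∃ c : GaloisField 2 2, A.1 ^ 3 = c • 1 ∨ A.1 ^ 5 = c • 1 := by
    rcases hg with hg | hg
    · obtain ⟨c, hc⟩ := hcen 3 (orderOf_dvd_iff_pow_eq_one.mp (by rw [hg]))
      exact ⟨c, Or.inl hc⟩
    · obtain ⟨c, hc⟩ := hcen 5 (orderOf_dvd_iff_pow_eq_one.mp (by rw [hg]))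
      exact ⟨c, Or.inr hc⟩
  obtain ⟨c, hc⟩ := hpow
  by_cases hcy : ∀ u : Fin 3 → GaloisField 2 2,
      (PslAux.cols u (A.1.mulVec u) (A.1.mulVec (A.1.mulVec u))).det = 0
  · exfalso
    obtain ⟨l, hl⟩ := PslAux.sq_scalar A.1 A.2 h4 hcy
    have hd : orderOf (QuotientGroup.mk A : Matrix.SpecialLinearGroup (Fin 3) (GaloisField 2 2) ⧸
      Subgroup.center (Matrix.SpecialLinearGroup (Fin 3) (GaloisField 2 2))) ∣ 2 := by
      apply orderOf_dvd_of_pow_eq_one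
      rw [← QuotientGroup.mk_pow, QuotientGroup.eq_one_iff, Subgroup.mem_center_iff]
      intro B
      apply Subtype.ext
      rw [Matrix.SpecialLinearGroup.coe_mul, Matrix.SpecialLinearGroup.coe_mul,
        Matrix.SpecialLinearGroup.coe_pow, pow_two, hl]
      simp
    rcases hg with hg | hg <;> rw [hg] at hd <;> revert hd <;> decide
  · push Not at hcy
    obtain ⟨u, hu⟩ := hcy
    obtain ⟨l, X, hl, hX, hAX⟩ := PslAux.cyc A.1 A.2 h4 u hu c hc
    let Y : Matrix.SpecialLinearGroup (Fin 3) (GaloisField 2 2) := ⟨X, hX⟩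
    rw [isConj_iff]
    refine ⟨QuotientGroup.mk Y, ?_⟩
    rw [mul_inv_eq_iff_eq_mul, eq_inv_mul_iff_mul_eq, ← mul_assoc, ← QuotientGroup.mk_mul,
      ← QuotientGroup.mk_mul]
    symm
    rw [QuotientGroup.eq]
    let Z : Matrix.SpecialLinearGroup (Fin 3) (GaloisField 2 2) := ⟨l • 1, by simp [hl]⟩
    have hZ : A * Y * A = Y * Z := by
      apply Subtype.ext
      change A.1 * X * A.1 = X * (l • 1)
      rw [hAX]; simp
    rw [hZ, inv_mul_cancel_left, Subgroup.mem_center_iff]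
    intro B
    apply Subtype.ext
    change B.1 * (l • 1) = (l • 1) * B.1
    simp
end
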